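/- Comparison principle: Let n, I, J ≥ 1 and T > 0. Let H : [0,T]×ℝ^n×ℝ^n×S_n×Δ(I)×Δ(J) → ℝ be continuous and satisfy the structure condition. Let w₁ : [0,T]×ℝ^n×Δ(I)×Δ(J) → ℝ be a bounded, Hölder continuous subsolution in the dual sense of w_t + H(t,x,Dw,D²w,p,q) = 0 which is uniformly Lipschitz continuous with respect to q, and let w₂ : [0,T]×ℝ^n×Δ(I)×Δ(J) → ℝ be a bounded, Hölder continuous supersolution in the dual sense of the same equation which is uniformly Lipschitz continuous with respect to p. Assume w₁(T,x,p,q) ≤ w₂(T,x,p,q) for all (x,p,q) ∈ ℝ^n×Δ(I)×Δ(J). Then w₁(t,x,p,q) ≤ w₂(t,x,p,q) for all (t,x,p,q) ∈ [0,T]×ℝ^n×Δ(I)×Δ(J). -/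

import Mathlib

open scoped RealInnerProductSpace
open Set Filter Topology MeasureTheory

noncomputable section

abbrev Euc (n : ℕ) := EuclideanSpace ℝ (Fin n)

/-- The standard simplex Δ(k) ⊆ ℝ^k. -/
def simplex (k : ℕ) : Set (Euc k) := {p | (∀ i, 0 ≤ p i) ∧ ∑ i, p i = 1}

/-- Quadratic form of a matrix. -/
def quadF {m : Type*} [Fintype m] (A : Matrix m m ℝ) (x : m → ℝ) : ℝ :=
  ∑ i, ∑ j, A i j * x i * x j

/-- Order of matrices in the sense of quadratic forms. -/
def matLE {m : Type*} [Fintype m] (A B : Matrix m m ℝ) : Prop :=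
  ∀ x : m → ℝ, quadF A x ≤ quadF B x

/-- Symmetric real matrices. -/
abbrev SymM (m : Type*) [Fintype m] := {A : Matrix m m ℝ // A.IsSymm}

def SymM.neg {m : Type*} [Fintype m] (A : SymM m) : SymM m := ⟨-A.1, A.2.neg⟩

/-- Convex conjugate in p over the simplex. -/
def conjP {n I J : ℕ} (w : ℝ → Euc n → Euc I → Euc J → ℝ) (t : ℝ) (x : Euc n)
    (phat : Euc I) (q : Euc J) : ℝ :=
  sSup ((fun p => ⟪phat, p⟫ - w t x p q) '' simplex I)

/-- Concave conjugate in q over the simplex. -/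
def conjQ {n I J : ℕ} (w : ℝ → Euc n → Euc I → Euc J → ℝ) (t : ℝ) (x : Euc n)
    (p : Euc I) (qhat : Euc J) : ℝ :=
  sInf ((fun q => ⟪qhat, q⟫ - w t x p q) '' simplex J)

def subdiffP {n I J : ℕ} (v : ℝ → Euc n → Euc I → Euc J → ℝ) (t : ℝ) (x : Euc n)
    (phat : Euc I) (q : Euc J) : Set (Euc I) :=
  {p | ∀ phat' : Euc I, v t x phat q + ⟪p, phat' - phat⟫ ≤ v t x phat' q}

def superdiffQ {n I J : ℕ} (v : ℝ → Euc n → Euc I → Euc J → ℝ) (t : ℝ) (x : Euc n)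
    (p : Euc I) (qhat : Euc J) : Set (Euc J) :=
  {q | ∀ qhat' : Euc J, v t x p qhat' ≤ v t x p qhat + ⟪q, qhat' - qhat⟫}

/-- `(φt, ξ, X)` is the first/second order derivative data of `φ` at `(tb, xb)`:
`φt` is the time partial derivative, `ξ` the spatial gradient and `X` the spatial Hessian. -/
def HasTestData {n : ℕ} (φ : ℝ → Euc n → ℝ) (tb : ℝ) (xb : Euc n)
    (φt : ℝ) (ξ : Euc n) (X : Matrix (Fin n) (Fin n) ℝ) : Prop :=
  HasDerivAt (fun s => φ s xb) φt tb ∧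
  HasGradientAt (fun y => φ tb y) ξ xb ∧
  HasFDerivAt (fun y => gradient (fun z => φ tb z) y)
    (Matrix.toEuclideanCLM (𝕜 := ℝ) X) xb

def uncur4 {n I J : ℕ} (w : ℝ → Euc n → Euc I → Euc J → ℝ) :
    ℝ × Euc n × Euc I × Euc J → ℝ :=
  fun z => w z.1 z.2.1 z.2.2.1 z.2.2.2

def dom4 (T : ℝ) (n I J : ℕ) : Set (ℝ × Euc n × Euc I × Euc J) :=
  Icc 0 T ×ˢ (univ : Set (Euc n)) ×ˢ simplex I ×ˢ simplex J

/-- `w` is a supersolution in the dual sense of `w_t + H(t,x,Dw,D²w,p,q) = 0`. -/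
def IsDualSupersolution {n I J : ℕ} (T : ℝ)
    (H : ℝ → Euc n → Euc n → SymM (Fin n) → Euc I → Euc J → ℝ)
    (w : ℝ → Euc n → Euc I → Euc J → ℝ) : Prop :=
  LowerSemicontinuousOn (uncur4 w) (dom4 T n I J) ∧
  (∀ t x p, ConcaveOn ℝ (simplex J) (fun q => w t x p q)) ∧
  ∀ φ : ℝ → Euc n → ℝ,
    ContDiffOn ℝ 2 (fun z : ℝ × Euc n => φ z.1 z.2) (Ioo 0 T ×ˢ (univ : Set (Euc n))) →
    ∀ tb ∈ Ioo (0:ℝ) T, ∀ xb : Euc n, ∀ phat : Euc I, ∀ qb ∈ simplex J,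
      (∀ t ∈ Ioo (0:ℝ) T, ∀ x : Euc n,
          conjP w t x phat qb - φ t x ≤ conjP w tb xb phat qb - φ tb xb) →
      ∀ (φt : ℝ) (ξ : Euc n) (X : SymM (Fin n)), HasTestData φ tb xb φt ξ X.1 →
        ∀ p ∈ subdiffP (conjP w) tb xb phat qb,
          0 ≤ φt - H tb xb (-ξ) (SymM.neg X) p qb

/-- `w` is a subsolution in the dual sense of `w_t + H(t,x,Dw,D²w,p,q) = 0`. -/
def IsDualSubsolution {n I J : ℕ} (T : ℝ)
    (H : ℝ → Euc n → Euc n → SymM (Fin n) → Euc I → Euc J → ℝ)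
    (w : ℝ → Euc n → Euc I → Euc J → ℝ) : Prop :=
  UpperSemicontinuousOn (uncur4 w) (dom4 T n I J) ∧
  (∀ t x q, ConvexOn ℝ (simplex I) (fun p => w t x p q)) ∧
  ∀ φ : ℝ → Euc n → ℝ,
    ContDiffOn ℝ 2 (fun z : ℝ × Euc n => φ z.1 z.2) (Ioo 0 T ×ˢ (univ : Set (Euc n))) →
    ∀ tb ∈ Ioo (0:ℝ) T, ∀ xb : Euc n, ∀ pb ∈ simplex I, ∀ qhat : Euc J,
      (∀ t ∈ Ioo (0:ℝ) T, ∀ x : Euc n,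
          conjQ w tb xb pb qhat - φ tb xb ≤ conjQ w t x pb qhat - φ t x) →
      ∀ (φt : ℝ) (ξ : Euc n) (X : SymM (Fin n)), HasTestData φ tb xb φt ξ X.1 →
        ∀ q ∈ superdiffQ (conjQ w) tb xb pb qhat,
          φt - H tb xb (-ξ) (SymM.neg X) pb q ≤ 0

/-- The structure condition on the Hamiltonian. -/
def StructCond {n I J : ℕ} (T : ℝ)
    (H : ℝ → Euc n → Euc n → SymM (Fin n) → Euc I → Euc J → ℝ) : Prop :=
  ∃ ω : ℝ → ℝ, Continuous ω ∧ Monotone ω ∧ ω 0 = 0 ∧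
    ∀ a b : ℝ, 0 ≤ a → 0 ≤ b →
    ∀ p ∈ simplex I, ∀ q ∈ simplex J,
    ∀ s ∈ Icc (0:ℝ) T, ∀ t ∈ Icc (0:ℝ) T,
    ∀ (x y ξ1 ξ2 : Euc n) (X1 X2 : SymM (Fin n)),
      matLE (Matrix.fromBlocks (-X1.1) 0 0 X2.1)
        (a • Matrix.fromBlocks (1 : Matrix (Fin n) (Fin n) ℝ) (-1) (-1) 1
          + b • (1 : Matrix (Fin n ⊕ Fin n) (Fin n ⊕ Fin n) ℝ)) →
      H s y ξ2 X2 p q - H t x ξ1 X1 p q ≥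
        -(ω (‖ξ1 - ξ2‖ + a * ((t - s) ^ 2 + ‖x - y‖ ^ 2) + b
            + Real.sqrt ((t - s) ^ 2 + ‖x - y‖ ^ 2) * (1 + ‖ξ1‖ + ‖ξ2‖)))



def cen (k : ℕ) : Euc k := WithLp.toLp 2 (fun _ => (1:ℝ) / k)

def mixA (k : ℕ) (δ : ℝ) (p : Euc k) : Euc k := (1 - δ) • p + δ • cen k

lemma cen_sum {k : ℕ} (hk : 1 ≤ k) : ∑ i, cen k i = 1 := by
  have : (k:ℝ) ≠ 0 := by positivity
  simp [cen, this]

lemma cen_pos {k : ℕ} (hk : 1 ≤ k) (i : Fin k) : 0 < cen k i := by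
  have : (0:ℝ) < k := by positivity
  simp [cen, this]

lemma cen_mem {k : ℕ} (hk : 1 ≤ k) : cen k ∈ simplex k :=
  ⟨fun i => (cen_pos hk i).le, cen_sum hk⟩

lemma simplex_convex (k : ℕ) : Convex ℝ (simplex k) := by
  intro p hp q hq a b ha hb hab
  refine ⟨fun i => ?_, ?_⟩
  · have := hp.1 i
    have := hq.1 i
    simp only [PiLp.add_apply, PiLp.smul_apply, smul_eq_mul]
    positivity
  · simp only [PiLp.add_apply, PiLp.smul_apply, smul_eq_mul, Finset.sum_add_distrib,
      ← Finset.mul_sum, hp.2, hq.2]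
    linarith

lemma simplex_compact (k : ℕ) : IsCompact (simplex k) := by
  have h := (isCompact_stdSimplex ℝ (Fin k)).image (PiLp.continuous_toLp 2 (fun _ : Fin k => ℝ))
  convert h using 1
  ext p
  constructor
  · intro hp
    exact ⟨WithLp.ofLp p, ⟨hp.1, hp.2⟩, rfl⟩
  · rintro ⟨q, hq, rfl⟩
    exact ⟨hq.1, hq.2⟩

lemma mixA_mem {k : ℕ} (hk : 1 ≤ k) {δ : ℝ} (h0 : 0 ≤ δ) (h1 : δ ≤ 1) {p : Euc k}
    (hp : p ∈ simplex k) : mixA k δ p ∈ simplex k :=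
  simplex_convex k hp (cen_mem hk) (by linarith) h0 (by ring)

lemma simplex_norm {k : ℕ} {p : Euc k} (hp : p ∈ simplex k) : ‖p‖ ≤ 1 := by
  have h1 : ∀ i, p i ≤ 1 := fun i => by
    rw [← hp.2]
    exact Finset.single_le_sum (f := fun i => p i) (fun j _ => hp.1 j) (Finset.mem_univ i)
  have h2 : ‖p‖ ^ 2 ≤ 1 := by
    rw [EuclideanSpace.real_norm_sq_eq, ← hp.2]
    refine Finset.sum_le_sum fun i _ => ?_
    nlinarith [hp.1 i, h1 i]
  nlinarith [norm_nonneg p]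

lemma mixA_dist {k : ℕ} (hk : 1 ≤ k) {δ : ℝ} (h0 : 0 ≤ δ) {p : Euc k}
    (hp : p ∈ simplex k) : dist (mixA k δ p) p ≤ 2 * δ := by
  have : mixA k δ p - p = δ • (cen k - p) := by
    unfold mixA; module
  rw [dist_eq_norm, this, norm_smul, Real.norm_of_nonneg h0]
  have := norm_sub_le (cen k) p
  have := simplex_norm hp
  have := simplex_norm (cen_mem hk)
  nlinarith

lemma mixA_cont (k : ℕ) (δ : ℝ) : Continuous (mixA k δ) := by
  unfold mixA; fun_prop

def projS (k : ℕ) (v : Euc k) : Euc k := v + (1 - ∑ i, v i) • cen k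

lemma projS_cont (k : ℕ) : Continuous (projS k) := by
  unfold projS; fun_prop

lemma projS_sum {k : ℕ} (hk : 1 ≤ k) (v : Euc k) : ∑ i, projS k v i = 1 := by
  simp only [projS, PiLp.add_apply, PiLp.smul_apply, smul_eq_mul, Finset.sum_add_distrib,
      ← Finset.mul_sum, cen_sum hk]
  ring

lemma projS_comb (k : ℕ) (u v : Euc k) (a b : ℝ) (hab : a + b = 1) :
    projS k (a • u + b • v) = a • projS k u + b • projS k v := by
  obtain rfl : b = 1 - a := by linarith
  ext i
  simp only [projS, PiLp.add_apply, PiLp.smul_apply, smul_eq_mul, Finset.sum_add_distrib,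
      ← Finset.mul_sum]
  ring

lemma projS_eq (k : ℕ) (v : Euc k) (hv : v ∈ simplex k) : projS k v = v := by
  simp [projS, hv.2]

/-- Existence of a subgradient at relative interior points. -/
lemma exists_subgrad {k : ℕ} (hk : 1 ≤ k) {f : Euc k → ℝ} (hf : ConvexOn ℝ (simplex k) f)
    (hc : ContinuousOn f (simplex k)) {δ : ℝ} (h0 : 0 < δ) (h1 : δ ≤ 1) {pb : Euc k}
    (hpb : pb ∈ simplex k) :
    ∃ v : Euc k, ∀ p ∈ simplex k, f (mixA k δ pb) + ⟪v, p - pb⟫ ≤ f (mixA k δ p) := by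
  set U : Set (Euc k) := {v | ∀ i, 0 < projS k v i} with hU
  have hUo : IsOpen U := by
    have : U = ⋂ i, {v | 0 < projS k v i} := by ext; simp [hU]
    rw [this]
    refine isOpen_iInter_of_finite fun i => ?_
    have := projS_cont k
    exact isOpen_lt (by fun_prop) (by fun_prop)
  have hUs : ∀ v ∈ U, projS k v ∈ simplex k := fun v hv => ⟨fun i => (hv i).le, projS_sum hk v⟩
  have hAU : ∀ p ∈ simplex k, mixA k δ p ∈ U := by
    intro p hp i
    rw [projS_eq k _ (mixA_mem hk h0.le h1 hp)]
    have := hp.1 i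
    have := cen_pos hk i
    simp only [mixA, PiLp.add_apply, PiLp.smul_apply, smul_eq_mul]
    have : 0 ≤ 1 - δ := by linarith
    positivity
  set S : Set (Euc k × ℝ) := {z | z.1 ∈ U ∧ f (projS k z.1) < z.2} with hS
  have hSo : IsOpen S := by
    have hco : ContinuousOn (fun z : Euc k × ℝ => z.2 - f (projS k z.1)) (Prod.fst ⁻¹' U) := by
      refine continuous_snd.continuousOn.sub ?_
      refine hc.comp ((projS_cont k).comp continuous_fst).continuousOn ?_
      intro z hz
      exact hUs _ hz
    have := hco.isOpen_inter_preimage (hUo.preimage continuous_fst) (isOpen_Ioi (a := (0:ℝ)))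
    convert this using 1
    ext z
    simp [hS]
  have hSc : Convex ℝ S := by
    rintro ⟨u, r⟩ ⟨hu, hur⟩ ⟨v, s⟩ ⟨hv, hvs⟩ a b ha hb hab
    simp only at hu hur hv hvs
    have hcb := projS_comb k u v a b hab
    refine ⟨?_, ?_⟩
    · intro i
      show 0 < projS k (a • u + b • v) i
      rw [hcb]
      simp only [PiLp.add_apply, PiLp.smul_apply, smul_eq_mul]
      have h3 := hu i
      have h4 := hv i
      rcases ha.eq_or_lt with rfl | ha'
      · have : b = 1 := by linarith
        subst this; simpa using h4
      · have := mul_pos ha' h3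
        have := mul_nonneg hb h4.le
        linarith
    · show f (projS k (a • u + b • v)) < a * r + b * s
      rw [hcb]
      have h5 := hf.2 (hUs u hu) (hUs v hv) ha hb hab
      simp only [smul_eq_mul] at h5
      refine h5.trans_lt ?_
      rcases ha.eq_or_lt with rfl | ha'
      · have : b = 1 := by linarith
        subst this; simpa using hvs
      · have := mul_lt_mul_of_pos_left hur ha'
        have := mul_le_mul_of_nonneg_left hvs.le hb
        linarith
  set P := mixA k δ pb with hP
  have hPs : P ∈ simplex k := mixA_mem hk h0.le h1 hpb
  have hnot : ((P, f P) : Euc k × ℝ) ∉ S := by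
    rintro ⟨_, h⟩
    simp only [projS_eq k P hPs, lt_irrefl] at h
  obtain ⟨L, hL⟩ := geometric_hahn_banach_point_open hSc hSo hnot
  set c : ℝ := L (0, 1) with hc'
  have hdec : ∀ u r, L (u, r) = L (u, 0) + r * c := by
    intro u r
    have : ((u, r) : Euc k × ℝ) = (u, 0) + r • (0, 1) := by simp
    rw [this, map_add, map_smul, smul_eq_mul]
  have hcpos : 0 < c := by
    have := hL (P, f P + 1) ⟨hAU _ hpb, by simp [projS_eq k P hPs]⟩
    rw [hdec P (f P), hdec P (f P + 1)] at this
    linarith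
  let ℓ : Euc k →L[ℝ] ℝ := L.comp (ContinuousLinearMap.inl ℝ (Euc k) ℝ)
  have hℓ : ∀ u, ℓ u = L (u, 0) := fun u => by simp [ℓ]
  refine ⟨(-(1 - δ) / c) • (InnerProductSpace.toDual ℝ (Euc k)).symm ℓ, fun p hp => ?_⟩
  rw [inner_smul_left, InnerProductSpace.toDual_symm_apply]
  simp only [conj_trivial]
  set Q := mixA k δ p with hQ
  have hQs : Q ∈ simplex k := mixA_mem hk h0.le h1 hp
  have hQP : ℓ Q - ℓ P = (1 - δ) * ℓ (p - pb) := by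
    rw [← map_sub, ← smul_eq_mul, ← map_smul]
    congr 1
    simp only [hQ, hP, mixA]; module
  have key : ∀ e > 0, ℓ P + f P * c ≤ ℓ Q + (f Q + e) * c := by
    intro e he
    have := hL (Q, f Q + e) ⟨hAU _ hp, by simp [projS_eq k Q hQs, he]⟩
    rw [hdec P (f P), hdec Q (f Q + e), ← hℓ, ← hℓ] at this
    exact this.le
  have key2 : ℓ P + f P * c ≤ ℓ Q + f Q * c := by
    refine le_of_forall_pos_le_add fun e he => ?_
    have := key (e / c) (by positivity)
    have h6 : e / c * c = e := by field_simp
    nlinarith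
  have h7 : -(1 - δ) / c * ℓ (p - pb) = (ℓ P - ℓ Q) / c := by
    have : ℓ P - ℓ Q = -((1 - δ) * ℓ (p - pb)) := by linarith
    rw [this]; ring
  rw [h7]
  have h8 : (ℓ P - ℓ Q) / c ≤ f Q - f P := by
    rw [div_le_iff₀ hcpos]; nlinarith
  linarith

def tst {n : ℕ} (a b g s0 : ℝ) (y0 : Euc n) (t : ℝ) (x : Euc n) : ℝ :=
  a / 2 * ((t - s0) ^ 2 + ‖x - y0‖ ^ 2) + b / 2 * ‖x‖ ^ 2 + g / t

lemma tst_contDiff {n : ℕ} (a b g s0 T : ℝ) (y0 : Euc n) :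
    ContDiffOn ℝ 2 (fun z : ℝ × Euc n => tst a b g s0 y0 z.1 z.2)
      (Ioo 0 T ×ˢ (univ : Set (Euc n))) := by
  unfold tst
  refine ContDiffOn.add (ContDiff.contDiffOn ?_) ?_
  · refine ContDiff.add ?_ ?_
    · refine contDiff_const.mul (ContDiff.add ?_ ?_)
      · fun_prop
      · exact ContDiff.norm_sq ℝ (by fun_prop)
    · exact contDiff_const.mul (ContDiff.norm_sq ℝ (by fun_prop))
  · refine ContDiffOn.div contDiffOn_const contDiff_fst.contDiffOn ?_
    rintro ⟨t, x⟩ ⟨ht, _⟩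
    exact ht.1.ne'

lemma tst_grad {n : ℕ} (a b g s0 : ℝ) (y0 : Euc n) (t : ℝ) (x : Euc n) :
    HasGradientAt (fun y => tst a b g s0 y0 t y) (a • (x - y0) + b • x) x := by
  rw [hasGradientAt_iff_hasFDerivAt]
  unfold tst
  have h1 : HasFDerivAt (fun y : Euc n => ‖y - y0‖ ^ 2) (2 • (innerSL ℝ (x - y0))) x := by
    have := (hasStrictFDerivAt_norm_sq (x - y0)).hasFDerivAt.comp x
      ((hasFDerivAt_id x).sub_const y0)
    exact this.congr_fderiv (by ext v; simp)
  have h2 : HasFDerivAt (fun y : Euc n => ‖y‖ ^ 2) (2 • (innerSL ℝ x)) x :=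
    (hasStrictFDerivAt_norm_sq x).hasFDerivAt
  have := (((h1.const_add ((t - s0) ^ 2)).const_mul (a / 2)).add (h2.const_mul (b / 2))).add_const
    (g / t)
  refine this.congr_fderiv ?_
  apply ContinuousLinearMap.ext
  intro v
  simp only [add_apply, smul_apply, smul_eq_mul,
    nsmul_eq_mul, innerSL_apply_apply, InnerProductSpace.toDual_apply_apply, inner_add_left,
    real_inner_smul_left]
  push_cast
  ring

lemma tst_data {n : ℕ} (a b g s0 : ℝ) (y0 : Euc n) (t : ℝ) (ht : 0 < t) (x : Euc n) :
    HasTestData (tst a b g s0 y0) t x (a * (t - s0) - g / t ^ 2) (a • (x - y0) + b • x)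
      ((a + b) • (1 : Matrix (Fin n) (Fin n) ℝ)) := by
  refine ⟨?_, tst_grad a b g s0 y0 t x, ?_⟩
  · unfold tst
    have h1 : HasDerivAt (fun s : ℝ => (s - s0) ^ 2) (2 * (t - s0)) t :=
      (((hasDerivAt_id t).sub_const s0).pow 2).congr_deriv (by simp)
    have h2 : HasDerivAt (fun s : ℝ => g / s) (g * (-(t ^ 2)⁻¹)) t :=
      (hasDerivAt_inv ht.ne').const_mul g
    have := (((h1.add_const (‖x - y0‖ ^ 2)).const_mul (a / 2)).add_const (b / 2 * ‖x‖ ^ 2)).add h2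
    exact this.congr_deriv (by ring)
  · have h : (fun y => gradient (fun z => tst a b g s0 y0 t z) y)
        = fun y => a • (y - y0) + b • y := by
      funext y
      exact (tst_grad a b g s0 y0 t y).gradient
    rw [h]
    have h2 : HasFDerivAt (fun y : Euc n => a • (y - y0) + b • y)
        (a • ContinuousLinearMap.id ℝ (Euc n) + b • ContinuousLinearMap.id ℝ (Euc n)) x :=
      (((hasFDerivAt_id x).sub_const y0).const_smul a).add ((hasFDerivAt_id x).const_smul b)
    refine h2.congr_fderiv ?_
    rw [map_smul, map_one]
    apply ContinuousLinearMap.ext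
    intro v
    simp [add_smul]

def scal (n : ℕ) (c : ℝ) : SymM (Fin n) :=
  ⟨c • (1 : Matrix (Fin n) (Fin n) ℝ), by simp [Matrix.IsSymm]⟩

lemma scal_neg (n : ℕ) (c : ℝ) : SymM.neg (scal n c) = scal n (-c) := by
  apply Subtype.ext; simp [SymM.neg, scal]

lemma quadF_scal {m : Type*} [Fintype m] [DecidableEq m] (c : ℝ) (x : m → ℝ) :
    quadF (c • (1 : Matrix m m ℝ)) x = c * ∑ i, x i ^ 2 := by
  simp only [quadF, Matrix.smul_apply, Matrix.one_apply, smul_eq_mul, Finset.mul_sum]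
  refine Finset.sum_congr rfl fun i _ => ?_
  simp [mul_assoc, sq]

lemma matLE_scal (n : ℕ) (c : ℝ) (hc : 0 ≤ c) :
    matLE (Matrix.fromBlocks (-(scal n c).1) 0 0 (scal n (-c)).1)
        ((0:ℝ) • Matrix.fromBlocks (1 : Matrix (Fin n) (Fin n) ℝ) (-1) (-1) 1
          + (0:ℝ) • (1 : Matrix (Fin n ⊕ Fin n) (Fin n ⊕ Fin n) ℝ)) := by
  intro x
  have h : Matrix.fromBlocks (-(scal n c).1) 0 0 (scal n (-c)).1
      = (-c) • (1 : Matrix (Fin n ⊕ Fin n) (Fin n ⊕ Fin n) ℝ) := by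
    rw [← Matrix.fromBlocks_one, Matrix.fromBlocks_smul]
    simp [scal]
  rw [h, quadF_scal]
  have : quadF ((0:ℝ) • Matrix.fromBlocks (1 : Matrix (Fin n) (Fin n) ℝ) (-1) (-1) 1
          + (0:ℝ) • (1 : Matrix (Fin n ⊕ Fin n) (Fin n ⊕ Fin n) ℝ)) x = 0 := by
    simp [quadF]
  rw [this]
  have : 0 ≤ ∑ i, x i ^ 2 := Finset.sum_nonneg fun i _ => sq_nonneg _
  nlinarith

lemma sub_ineq {n I J : ℕ} {T : ℝ}
    {H : ℝ → Euc n → Euc n → SymM (Fin n) → Euc I → Euc J → ℝ}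
    {w : ℝ → Euc n → Euc I → Euc J → ℝ} (hsub : IsDualSubsolution T H w)
    {φ : ℝ → Euc n → ℝ}
    (hφ : ContDiffOn ℝ 2 (fun z : ℝ × Euc n => φ z.1 z.2) (Ioo 0 T ×ˢ (univ : Set (Euc n))))
    {tb : ℝ} (ht : tb ∈ Ioo (0:ℝ) T) {xb : Euc n} {pb : Euc I} (hp : pb ∈ simplex I)
    {qb qhat : Euc J} (hq : qb ∈ simplex J)
    {M : ℝ} (hM : ∀ q ∈ simplex J, w tb xb pb q ≤ M)
    (hmin : ∀ t ∈ Ioo (0:ℝ) T, ∀ x : Euc n, ∀ q ∈ simplex J,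
      ⟪qhat, qb⟫ - w tb xb pb qb - φ tb xb ≤ ⟪qhat, q⟫ - w t x pb q - φ t x)
    {φt : ℝ} {ξ : Euc n} {X : SymM (Fin n)} (hd : HasTestData φ tb xb φt ξ X.1) :
    φt ≤ H tb xb (-ξ) (SymM.neg X) pb qb := by
  have hbd : ∀ v : Euc J, BddBelow ((fun q => ⟪v, q⟫ - w tb xb pb q) '' simplex J) := by
    intro v
    refine ⟨-‖v‖ - M, ?_⟩
    rintro _ ⟨q, hq', rfl⟩
    have h1 := abs_le.1 (abs_real_inner_le_norm v q)
    have h2 := simplex_norm hq'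
    have h3 := hM q hq'
    have h4 := norm_nonneg v
    have h5 : ‖v‖ * ‖q‖ ≤ ‖v‖ := by nlinarith
    show _ ≤ ⟪v, q⟫ - w tb xb pb q
    linarith [h1.1]
  have hle : ∀ v : Euc J, conjQ w tb xb pb v ≤ ⟪v, qb⟫ - w tb xb pb qb :=
    fun v => csInf_le (hbd v) ⟨qb, hq, rfl⟩
  have hge : ∀ t ∈ Ioo (0:ℝ) T, ∀ x, ⟪qhat, qb⟫ - w tb xb pb qb - φ tb xb + φ t x
      ≤ conjQ w t x pb qhat := by
    intro t ht' x
    refine le_csInf ⟨_, qb, hq, rfl⟩ ?_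
    rintro _ ⟨q, hq', rfl⟩
    have := hmin t ht' x q hq'
    simp only
    linarith
  have := hsub.2.2 φ hφ tb ht xb pb hp qhat
    (fun t ht' x => by have := hge t ht' x; have := hle qhat; linarith) φt ξ X hd qb
    (fun v => by
      have h1 := hge tb ht xb
      have h2 := hle v
      rw [inner_sub_right, real_inner_comm, real_inner_comm qhat qb]
      linarith)
  linarith

lemma super_ineq {n I J : ℕ} {T : ℝ}
    {H : ℝ → Euc n → Euc n → SymM (Fin n) → Euc I → Euc J → ℝ}
    {w : ℝ → Euc n → Euc I → Euc J → ℝ} (hsup : IsDualSupersolution T H w)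
    {φ : ℝ → Euc n → ℝ}
    (hφ : ContDiffOn ℝ 2 (fun z : ℝ × Euc n => φ z.1 z.2) (Ioo 0 T ×ˢ (univ : Set (Euc n))))
    {tb : ℝ} (ht : tb ∈ Ioo (0:ℝ) T) {xb : Euc n} {qb : Euc J} (hq : qb ∈ simplex J)
    {pb phat : Euc I} (hp : pb ∈ simplex I)
    {M : ℝ} (hM : ∀ p ∈ simplex I, -M ≤ w tb xb p qb)
    (hmax : ∀ t ∈ Ioo (0:ℝ) T, ∀ x : Euc n, ∀ p ∈ simplex I,
      ⟪phat, p⟫ - w t x p qb - φ t x ≤ ⟪phat, pb⟫ - w tb xb pb qb - φ tb xb)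
    {φt : ℝ} {ξ : Euc n} {X : SymM (Fin n)} (hd : HasTestData φ tb xb φt ξ X.1) :
    H tb xb (-ξ) (SymM.neg X) pb qb ≤ φt := by
  have hbd : ∀ v : Euc I, BddAbove ((fun p => ⟪v, p⟫ - w tb xb p qb) '' simplex I) := by
    intro v
    refine ⟨‖v‖ + M, ?_⟩
    rintro _ ⟨q, hq', rfl⟩
    have h1 := abs_le.1 (abs_real_inner_le_norm v q)
    have h2 := simplex_norm hq'
    have h3 := hM q hq'
    have h4 := norm_nonneg v
    have h5 : ‖v‖ * ‖q‖ ≤ ‖v‖ := by nlinarith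
    show ⟪v, q⟫ - w tb xb q qb ≤ _
    linarith [h1.2]
  have hle : ∀ v : Euc I, ⟪v, pb⟫ - w tb xb pb qb ≤ conjP w tb xb v qb :=
    fun v => le_csSup (hbd v) ⟨pb, hp, rfl⟩
  have hge : ∀ t ∈ Ioo (0:ℝ) T, ∀ x, conjP w t x phat qb ≤
      ⟪phat, pb⟫ - w tb xb pb qb - φ tb xb + φ t x := by
    intro t ht' x
    refine csSup_le ⟨_, pb, hp, rfl⟩ ?_
    rintro _ ⟨q, hq', rfl⟩
    have := hmax t ht' x q hq'
    simp only
    linarith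
  have := hsup.2.2 φ hφ tb ht xb phat qb hq
    (fun t ht' x => by have := hge t ht' x; have := hle phat; linarith) φt ξ X hd pb
    (fun v => by
      have h1 := hge tb ht xb
      have h2 := hle v
      rw [inner_sub_right, real_inner_comm, real_inner_comm phat pb]
      linarith)
  linarith

/-- The doubled penalisation. -/
def pen {n : ℕ} (α β γ : ℝ) (t : ℝ) (x : Euc n) (s : ℝ) (y : Euc n) : ℝ :=
  α / 2 * ((t - s) ^ 2 + ‖x - y‖ ^ 2) + β / 2 * (‖x‖ ^ 2 + ‖y‖ ^ 2) + (γ / t + γ / s)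

lemma exists_max {n I J : ℕ} {T : ℝ} {α β γ M : ℝ} (hα : 0 ≤ α) (hβ : 0 < β) (hγ : 0 < γ)
    (hM : 0 < M)
    (F : ℝ → Euc n → ℝ → Euc n → Euc I → Euc J → ℝ)
    (hF : ContinuousOn (fun z : ℝ × Euc n × ℝ × Euc n × Euc I × Euc J =>
        F z.1 z.2.1 z.2.2.1 z.2.2.2.1 z.2.2.2.2.1 z.2.2.2.2.2)
      (Icc 0 T ×ˢ (univ : Set (Euc n)) ×ˢ Icc 0 T ×ˢ (univ : Set (Euc n)) ×ˢ
        simplex I ×ˢ simplex J))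
    (hFM : ∀ t ∈ Icc 0 T, ∀ x, ∀ s ∈ Icc 0 T, ∀ y, ∀ p ∈ simplex I, ∀ q ∈ simplex J,
      F t x s y p q ≤ M)
    {t0 : ℝ} (ht0 : t0 ∈ Ioc 0 T) {x0 : Euc n} {p0 : Euc I} (hp0 : p0 ∈ simplex I)
    {q0 : Euc J} (hq0 : q0 ∈ simplex J)
    (hpos : 0 < F t0 x0 t0 x0 p0 q0 - pen α β γ t0 x0 t0 x0) :
    ∃ tb ∈ Ioc 0 T, ∃ xb, ∃ sb ∈ Ioc 0 T, ∃ yb, ∃ pb ∈ simplex I, ∃ qb ∈ simplex J,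
      ∀ t ∈ Ioc 0 T, ∀ x, ∀ s ∈ Ioc 0 T, ∀ y, ∀ p ∈ simplex I, ∀ q ∈ simplex J,
        F t x s y p q - pen α β γ t x s y ≤ F tb xb sb yb pb qb - pen α β γ tb xb sb yb := by
  set τ := γ / M with hτ
  have hτ0 : 0 < τ := by positivity
  set R := Real.sqrt (2 * M / β) with hR
  let K : Set (ℝ × Euc n × ℝ × Euc n × Euc I × Euc J) :=
    Icc τ T ×ˢ Metric.closedBall (0 : Euc n) R ×ˢ Icc τ T ×ˢ Metric.closedBall (0 : Euc n) R ×ˢ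
        simplex I ×ˢ simplex J
  have hK : IsCompact K := isCompact_Icc.prod ((isCompact_closedBall _ _).prod
    (isCompact_Icc.prod ((isCompact_closedBall _ _).prod
      ((simplex_compact I).prod (simplex_compact J)))))
  have hin : ∀ t ∈ Ioc 0 T, ∀ x, ∀ s ∈ Ioc 0 T, ∀ y, ∀ p ∈ simplex I, ∀ q ∈ simplex J,
      0 < F t x s y p q - pen α β γ t x s y → (t, x, s, y, p, q) ∈ K := by
    intro t ht x s hs y p hp q hq h
    have h1 := hFM t (Ioc_subset_Icc_self ht) x s (Ioc_subset_Icc_self hs) y p hp q hq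
    unfold pen at h
    have e1 : 0 ≤ α / 2 * ((t - s) ^ 2 + ‖x - y‖ ^ 2) := by positivity
    have e2 : 0 ≤ β / 2 * ‖x‖ ^ 2 := by positivity
    have e3 : 0 ≤ β / 2 * ‖y‖ ^ 2 := by positivity
    have e4 : 0 < γ / t := div_pos hγ ht.1
    have e5 : 0 < γ / s := div_pos hγ hs.1
    have hx : ∀ v : Euc n, β / 2 * ‖v‖ ^ 2 ≤ M → v ∈ Metric.closedBall (0 : Euc n) R := by
      intro v hv
      rw [mem_closedBall_zero_iff]
      refine Real.le_sqrt_of_sq_le ?_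
      rw [le_div_iff₀ hβ]; linarith
    have ht' : ∀ r : ℝ, 0 < r → γ / r ≤ M → τ ≤ r := by
      intro r hr h
      rw [hτ, div_le_iff₀ hM]
      rw [div_le_iff₀ hr] at h
      linarith
    exact ⟨⟨ht' t ht.1 (by linarith), ht.2⟩, hx x (by linarith),
      ⟨ht' s hs.1 (by linarith), hs.2⟩, hx y (by linarith), hp, hq⟩
  have h0K := hin t0 ht0 x0 t0 ht0 x0 p0 hp0 q0 hq0 hpos
  have hcont : ContinuousOn (fun z : ℝ × Euc n × ℝ × Euc n × Euc I × Euc J =>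
        F z.1 z.2.1 z.2.2.1 z.2.2.2.1 z.2.2.2.2.1 z.2.2.2.2.2
          - pen α β γ z.1 z.2.1 z.2.2.1 z.2.2.2.1) K := by
    refine (hF.mono ?_).sub ?_
    · rintro ⟨t, x, s, y, p, q⟩ ⟨h1, h2, h3, h4, h5, h6⟩
      exact ⟨⟨hτ0.le.trans h1.1, h1.2⟩, mem_univ _, ⟨hτ0.le.trans h3.1, h3.2⟩, mem_univ _, h5, h6⟩
    · unfold pen
      refine ContinuousOn.add (Continuous.continuousOn (by fun_prop)) (ContinuousOn.add ?_ ?_)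
      · refine continuousOn_const.div (by fun_prop) ?_
        rintro ⟨t, x, s, y, p, q⟩ ⟨h1, h2, h3, h4, h5, h6⟩
        exact (hτ0.trans_le h1.1).ne'
      · refine continuousOn_const.div (by fun_prop) ?_
        rintro ⟨t, x, s, y, p, q⟩ ⟨h1, h2, h3, h4, h5, h6⟩
        exact (hτ0.trans_le h3.1).ne'
  obtain ⟨⟨tb, xb, sb, yb, pb, qb⟩, ⟨h1, h2, h3, h4, h5, h6⟩, hmax⟩ :=
    hK.exists_isMaxOn ⟨_, h0K⟩ hcont
  refine ⟨tb, ⟨hτ0.trans_le h1.1, h1.2⟩, xb, sb, ⟨hτ0.trans_le h3.1, h3.2⟩, yb, pb, h5, qb, h6, ?_⟩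
  intro t ht x s hs y p hp q hq
  by_cases h : 0 < F t x s y p q - pen α β γ t x s y
  · exact hmax (hin t ht x s hs y p hp q hq h)
  · have := hmax h0K
    simp only [mem_ofPred_eq] at this
    linarith

lemma holder_unif {X : Type*} [PseudoMetricSpace X] {f : X → ℝ} {s : Set X}
    (h : ∃ C θ : ℝ, 0 < θ ∧ θ ≤ 1 ∧ ∀ z ∈ s, ∀ z' ∈ s, |f z - f z'| ≤ C * dist z z' ^ θ) :
    UniformContinuousOn f s := by
  obtain ⟨C, θ, h0, -, h⟩ := h
  rw [Metric.uniformContinuousOn_iff]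
  intro e he
  have hc : ContinuousAt (fun d : ℝ => C * d ^ θ) 0 :=
    (Real.continuousAt_rpow_const 0 θ (Or.inr h0.le)).const_mul C
  obtain ⟨d, hd, hd'⟩ := Metric.continuousAt_iff.1 hc e he
  refine ⟨d, hd, fun z hz z' hz' hzz => ?_⟩
  have := hd' (x := dist z z') (by rwa [Real.dist_0_eq_abs, abs_of_nonneg dist_nonneg])
  rw [Real.zero_rpow h0.ne', mul_zero, Real.dist_0_eq_abs] at this
  rw [Real.dist_eq]
  exact (h z hz z' hz').trans_lt ((le_abs_self _).trans_lt this)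

set_option maxHeartbeats 2000000 in
lemma core {n I J : ℕ} (hI : 1 ≤ I) (hJ : 1 ≤ J)
    {T : ℝ} (hT : 0 < T)
    (H : ℝ → Euc n → Euc n → SymM (Fin n) → Euc I → Euc J → ℝ)
    (Hcont : ContinuousOn
      (fun z : ℝ × Euc n × Euc n × SymM (Fin n) × Euc I × Euc J =>
        H z.1 z.2.1 z.2.2.1 z.2.2.2.1 z.2.2.2.2.1 z.2.2.2.2.2)
      (Icc 0 T ×ˢ (univ : Set (Euc n)) ×ˢ (univ : Set (Euc n)) ×ˢ
        (univ : Set (SymM (Fin n))) ×ˢ simplex I ×ˢ simplex J))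
    (Hstruct : StructCond T H)
    (w1 w2 : ℝ → Euc n → Euc I → Euc J → ℝ)
    {M : ℝ} (hM : 0 < M)
    (hb1 : ∀ z ∈ dom4 T n I J, |uncur4 w1 z| ≤ M)
    (hb2 : ∀ z ∈ dom4 T n I J, |uncur4 w2 z| ≤ M)
    (hu1 : UniformContinuousOn (uncur4 w1) (dom4 T n I J))
    (hu2 : UniformContinuousOn (uncur4 w2) (dom4 T n I J))
    (hsub : IsDualSubsolution T H w1)
    (hsuper : IsDualSupersolution T H w2)
    (hterm : ∀ x : Euc n, ∀ p ∈ simplex I, ∀ q ∈ simplex J, w1 T x p q ≤ w2 T x p q)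
    {t0 : ℝ} (ht0 : t0 ∈ Ioc (0:ℝ) T) {x0 : Euc n} {p0 : Euc I} (hp0 : p0 ∈ simplex I)
    {q0 : Euc J} (hq0 : q0 ∈ simplex J) (hlt : w2 t0 x0 p0 q0 < w1 t0 x0 p0 q0) : False := by
  obtain ⟨ω, hωc, hωm, hω0, hstr⟩ := Hstruct
  set D := w1 t0 x0 p0 q0 - w2 t0 x0 p0 q0 with hD
  have hDpos : 0 < D := by linarith
  have ht0p := ht0.1
  set γ := D * t0 / 8 with hγd
  have hγ : 0 < γ := by positivity
  have hγT : 0 < γ / T ^ 2 := by positivity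
  obtain ⟨ρ, hρ, hωρ⟩ := Metric.continuousAt_iff.1 (hωc.continuousAt (x := 0)) _ hγT
  set μ := min (D / 16) (ρ / 16) with hμd
  have hμ : 0 < μ := by positivity
  have hμ1 : μ ≤ D / 16 := min_le_left _ _
  have hμ2 : μ ≤ ρ / 16 := min_le_right _ _
  obtain ⟨r1, hr1, hmod1⟩ := Metric.uniformContinuousOn_iff.1 hu1 μ hμ
  obtain ⟨r2, hr2, hmod2⟩ := Metric.uniformContinuousOn_iff.1 hu2 μ hμ
  set e := min (min r1 r2) (min (ρ / 8) 1) / 2 with hed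
  have he : 0 < e := by positivity
  have he1 : e < r1 := by
    have h1 := (min_le_left (min r1 r2) (min (ρ / 8) 1)).trans (min_le_left r1 r2)
    rw [hed]; linarith
  have he2 : e < r2 := by
    have h1 := (min_le_left (min r1 r2) (min (ρ / 8) 1)).trans (min_le_right r1 r2)
    rw [hed]; linarith
  have he3 : e ≤ ρ / 8 := by
    have h1 := (min_le_right (min r1 r2) (min (ρ / 8) 1)).trans (min_le_left (ρ / 8) 1)
    rw [hed]; linarith
  have he4 : e ≤ 1 := by
    have h1 := (min_le_right (min r1 r2) (min (ρ / 8) 1)).trans (min_le_right (ρ / 8) 1)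
    rw [hed]; linarith
  set α := 4 * M / e ^ 2 with hαd
  have hα : 0 < α := by positivity
  set β := min (ρ ^ 2 / (1024 * M)) (D / (4 * (1 + ‖x0‖ ^ 2))) with hβd
  have hβ : 0 < β := by positivity
  have hβ1 : β * M * 1024 ≤ ρ ^ 2 := by
    have h := min_le_left (ρ ^ 2 / (1024 * M)) (D / (4 * (1 + ‖x0‖ ^ 2)))
    rw [← hβd, le_div_iff₀ (by positivity)] at h
    linarith
  have hβ2 : β * ‖x0‖ ^ 2 ≤ D / 4 := by
    have h := min_le_right (ρ ^ 2 / (1024 * M)) (D / (4 * (1 + ‖x0‖ ^ 2)))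
    rw [← hβd, le_div_iff₀ (by positivity)] at h
    nlinarith
  set X1 := scal n (α + β) with hX1
  set Rx := ρ / (16 * β) with hRx
  set Rξ := α * e + ρ / 16 with hRξ
  let KH : Set (ℝ × Euc n × Euc n × Euc I × Euc J) :=
    Icc 0 T ×ˢ Metric.closedBall 0 Rx ×ˢ Metric.closedBall 0 Rξ ×ˢ simplex I ×ˢ simplex J
  have hKH : IsCompact KH := isCompact_Icc.prod ((isCompact_closedBall _ _).prod
    ((isCompact_closedBall _ _).prod ((simplex_compact I).prod (simplex_compact J))))
  have hHc : ContinuousOn (fun z : ℝ × Euc n × Euc n × Euc I × Euc J =>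
      H z.1 z.2.1 z.2.2.1 X1 z.2.2.2.1 z.2.2.2.2) KH := by
    refine Hcont.comp (f := fun z : ℝ × Euc n × Euc n × Euc I × Euc J =>
      (z.1, z.2.1, z.2.2.1, X1, z.2.2.2.1, z.2.2.2.2)) (by fun_prop) ?_
    rintro ⟨t, x, ξ, p, q⟩ ⟨h1, h2, h3, h4, h5⟩
    exact ⟨h1, mem_univ _, mem_univ _, mem_univ _, h4, h5⟩
  obtain ⟨η, hη, hHη⟩ := Metric.uniformContinuousOn_iff.1
    (hKH.uniformContinuousOn_of_continuous hHc) _ hγT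
  set δ := min (min (r1 / 4) (r2 / 4)) (min (η / 4) 1) with hδd
  have hδ : 0 < δ := by positivity
  have hδ1 : 2 * δ < r1 := by
    have h1 : δ ≤ r1 / 4 := (min_le_left _ _).trans (min_le_left _ _)
    linarith
  have hδ2 : 2 * δ < r2 := by
    have h1 : δ ≤ r2 / 4 := (min_le_left _ _).trans (min_le_right _ _)
    linarith
  have hδ3 : 2 * δ < η := by
    have h1 : δ ≤ η / 4 := (min_le_right _ _).trans (min_le_left _ _)
    linarith
  have hδ4 : δ ≤ 1 := (min_le_right _ _).trans (min_le_right _ _)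
  have hAI : ∀ p ∈ simplex I, mixA I δ p ∈ simplex I := fun p hp => mixA_mem hI hδ.le hδ4 hp
  have hAJ : ∀ p ∈ simplex J, mixA J δ p ∈ simplex J := fun p hp => mixA_mem hJ hδ.le hδ4 hp
  -- pointwise moduli
  have hB1 : ∀ t ∈ Icc 0 T, ∀ x, ∀ p ∈ simplex I, ∀ q ∈ simplex J, |w1 t x p q| ≤ M :=
    fun t ht x p hp q hq => hb1 (t, x, p, q) ⟨ht, mem_univ _, hp, hq⟩
  have hB2 : ∀ t ∈ Icc 0 T, ∀ x, ∀ p ∈ simplex I, ∀ q ∈ simplex J, |w2 t x p q| ≤ M :=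
    fun t ht x p hp q hq => hb2 (t, x, p, q) ⟨ht, mem_univ _, hp, hq⟩
  have hm1 : ∀ t ∈ Icc 0 T, ∀ x, ∀ p ∈ simplex I, ∀ q ∈ simplex J,
      ∀ t' ∈ Icc 0 T, ∀ x', ∀ p' ∈ simplex I, ∀ q' ∈ simplex J,
      |t - t'| < r1 → ‖x - x'‖ < r1 → dist p p' < r1 → dist q q' < r1 →
      |w1 t x p q - w1 t' x' p' q'| < μ := by
    intro t ht x p hp q hq t' ht' x' p' hp' q' hq' a b c d
    refine hmod1 (t, x, p, q) ⟨ht, mem_univ _, hp, hq⟩ (t', x', p', q')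
      ⟨ht', mem_univ _, hp', hq'⟩ ?_
    simp only [Prod.dist_eq, max_lt_iff]
    exact ⟨a, by rwa [dist_eq_norm], c, d⟩
  have hm2 : ∀ t ∈ Icc 0 T, ∀ x, ∀ p ∈ simplex I, ∀ q ∈ simplex J,
      ∀ t' ∈ Icc 0 T, ∀ x', ∀ p' ∈ simplex I, ∀ q' ∈ simplex J,
      |t - t'| < r2 → ‖x - x'‖ < r2 → dist p p' < r2 → dist q q' < r2 →
      |w2 t x p q - w2 t' x' p' q'| < μ := by
    intro t ht x p hp q hq t' ht' x' p' hp' q' hq' a b c d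
    refine hmod2 (t, x, p, q) ⟨ht, mem_univ _, hp, hq⟩ (t', x', p', q')
      ⟨ht', mem_univ _, hp', hq'⟩ ?_
    simp only [Prod.dist_eq, max_lt_iff]
    exact ⟨a, by rwa [dist_eq_norm], c, d⟩
  let F : ℝ → Euc n → ℝ → Euc n → Euc I → Euc J → ℝ :=
    fun t x s y p q => w1 t x (mixA I δ p) q - w2 s y p (mixA J δ q)
  have hF : ContinuousOn (fun z : ℝ × Euc n × ℝ × Euc n × Euc I × Euc J =>
        F z.1 z.2.1 z.2.2.1 z.2.2.2.1 z.2.2.2.2.1 z.2.2.2.2.2)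
      (Icc 0 T ×ˢ (univ : Set (Euc n)) ×ˢ Icc 0 T ×ˢ (univ : Set (Euc n)) ×ˢ
        simplex I ×ˢ simplex J) := by
    have cI := mixA_cont I δ
    have cJ := mixA_cont J δ
    refine ContinuousOn.sub ?_ ?_
    · refine hu1.continuousOn.comp (f := fun z : ℝ × Euc n × ℝ × Euc n × Euc I × Euc J =>
        (z.1, z.2.1, mixA I δ z.2.2.2.2.1, z.2.2.2.2.2)) (by fun_prop) ?_
      rintro ⟨t, x, s, y, p, q⟩ ⟨h1, h2, h3, h4, h5, h6⟩
      exact ⟨h1, mem_univ _, hAI _ h5, h6⟩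
    · refine hu2.continuousOn.comp (f := fun z : ℝ × Euc n × ℝ × Euc n × Euc I × Euc J =>
        (z.2.2.1, z.2.2.2.1, z.2.2.2.2.1, mixA J δ z.2.2.2.2.2)) (by fun_prop) ?_
      rintro ⟨t, x, s, y, p, q⟩ ⟨h1, h2, h3, h4, h5, h6⟩
      exact ⟨h3, mem_univ _, h5, hAJ _ h6⟩
  have hFM : ∀ t ∈ Icc 0 T, ∀ x, ∀ s ∈ Icc 0 T, ∀ y, ∀ p ∈ simplex I, ∀ q ∈ simplex J,
      F t x s y p q ≤ 2 * M := by
    intro t ht x s hs y p hp q hq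
    have h1 := abs_le.1 (hB1 t ht x _ (hAI p hp) q hq)
    have h2 := abs_le.1 (hB2 s hs y p hp _ (hAJ q hq))
    simp only [F]
    linarith [h1.2, h2.1]
  have ht0' : t0 ∈ Icc 0 T := Ioc_subset_Icc_self ht0
  have hΦ0 : D / 4 < F t0 x0 t0 x0 p0 q0 - pen α β γ t0 x0 t0 x0 := by
    have h1 := abs_lt.1 (hm1 t0 ht0' x0 _ (hAI p0 hp0) q0 hq0 t0 ht0' x0 p0 hp0 q0 hq0
      (by simpa) (by simpa) ((mixA_dist hI hδ.le hp0).trans_lt hδ1) (by simpa))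
    have h2 := abs_lt.1 (hm2 t0 ht0' x0 p0 hp0 _ (hAJ q0 hq0) t0 ht0' x0 p0 hp0 q0 hq0
      (by simpa) (by simpa) (by simpa) ((mixA_dist hJ hδ.le hq0).trans_lt hδ2))
    have h3 : γ / t0 = D / 8 := by rw [hγd]; field_simp
    have h4 : pen α β γ t0 x0 t0 x0 = β * ‖x0‖ ^ 2 + D / 4 := by
      simp only [pen, h3, sub_self, norm_zero]; ring
    rw [h4]
    simp only [F]
    linarith [h1.1, h2.2]
  obtain ⟨tb, htb, xb, sb, hsb, yb, pb, hpb, qb, hqb, hmax⟩ :=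
    exists_max hα.le hβ hγ (by positivity : 0 < 2 * M) F hF hFM ht0 hp0 hq0 (by linarith)
  have htb' : tb ∈ Icc 0 T := Ioc_subset_Icc_self htb
  have hsb' : sb ∈ Icc 0 T := Ioc_subset_Icc_self hsb
  have htbp := htb.1
  have hsbp := hsb.1
  have hΦb := hΦ0.trans_le (hmax t0 ht0 x0 t0 ht0 x0 p0 hp0 q0 hq0)
  set r := Real.sqrt ((tb - sb) ^ 2 + ‖xb - yb‖ ^ 2) with hr
  have hr0 : 0 ≤ r := Real.sqrt_nonneg _
  have hr2 : r ^ 2 = (tb - sb) ^ 2 + ‖xb - yb‖ ^ 2 := Real.sq_sqrt (by positivity)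
  have hFb := hFM tb htb' xb sb hsb' yb pb hpb qb hqb
  have g1 : 0 < γ / tb := by positivity
  have g2 : 0 < γ / sb := by positivity
  have hpb4 : pen α β γ tb xb sb yb ≤ 2 * M := by linarith
  have hpen : pen α β γ tb xb sb yb
      = α / 2 * r ^ 2 + (β / 2 * ‖xb‖ ^ 2 + β / 2 * ‖yb‖ ^ 2) + (γ / tb + γ / sb) := by
    rw [hr2]; unfold pen; ring
  have a1 : 0 ≤ α / 2 * r ^ 2 := by positivity
  have a2 : 0 ≤ β / 2 * ‖xb‖ ^ 2 := by positivity
  have a3 : 0 ≤ β / 2 * ‖yb‖ ^ 2 := by positivity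
  have hre : r ≤ e := by
    have h1 : α / 2 * r ^ 2 ≤ 2 * M := by linarith
    have h2 : α * e ^ 2 = 4 * M := by rw [hαd]; field_simp
    have h3 : α * r ^ 2 ≤ α * e ^ 2 := by linarith
    have h4 : r ^ 2 ≤ e ^ 2 := le_of_mul_le_mul_left h3 hα
    exact (pow_le_pow_iff_left₀ hr0 he.le two_ne_zero).1 h4
  have hts : |tb - sb| ≤ r := by
    refine Real.le_sqrt_of_sq_le ?_
    rw [sq_abs]; exact le_add_of_nonneg_right (sq_nonneg _)
  have hxy : ‖xb - yb‖ ≤ r := by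
    refine Real.le_sqrt_of_sq_le ?_
    exact le_add_of_nonneg_left (sq_nonneg _)
  have hxbnd : ∀ v : Euc n, β / 2 * ‖v‖ ^ 2 ≤ 2 * M → β * ‖v‖ ≤ ρ / 16 := by
    intro v hv
    have h1 : (β * ‖v‖) ^ 2 ≤ (ρ / 16) ^ 2 := by
      have h2 := mul_le_mul_of_nonneg_left hv hβ.le
      have h3 : (β * ‖v‖) ^ 2 = 2 * (β * (β / 2 * ‖v‖ ^ 2)) := by ring
      have h4 : (ρ / 16) ^ 2 = ρ ^ 2 / 256 := by ring
      rw [h3, h4]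
      linarith
    exact (pow_le_pow_iff_left₀ (by positivity) (by positivity) two_ne_zero).1 h1
  have hxb := hxbnd xb (by linarith)
  have hyb := hxbnd yb (by linarith)
  have hAp := hAI pb hpb
  have hAq := hAJ qb hqb
  -- α r² small
  have hαr : α * r ^ 2 ≤ 2 * μ := by
    have h1 := hmax tb htb xb tb htb xb pb hpb qb hqb
    have h2 := hmax sb hsb yb sb hsb yb pb hpb qb hqb
    have h3 := abs_lt.1 (hm1 tb htb' xb _ hAp qb hqb sb hsb' yb _ hAp qb hqb
      (by linarith) (by linarith) (by simpa) (by simpa))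
    have h4 := abs_lt.1 (hm2 tb htb' xb pb hpb _ hAq sb hsb' yb pb hpb _ hAq
      (by linarith) (by linarith) (by simpa) (by simpa))
    rw [hpen] at h1 h2
    simp only [pen, F, sub_self, norm_zero] at h1 h2
    linarith [h3.2, h4.2]
  -- times are interior
  have hpen0 : 0 ≤ pen α β γ tb xb sb yb := by rw [hpen]; linarith
  have htT : tb < T := by
    refine lt_of_le_of_ne htb.2 fun h => ?_
    have h1 := abs_lt.1 (hm1 tb htb' xb _ hAp qb hqb tb htb' xb pb hpb qb hqb
      (by simpa) (by simpa) ((mixA_dist hI hδ.le hpb).trans_lt hδ1) (by simpa))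
    have h2 := abs_lt.1 (hm2 tb htb' xb pb hpb qb hqb sb hsb' yb pb hpb _ hAq
      (by linarith) (by linarith) (by simpa)
      (by rw [dist_comm]; exact (mixA_dist hJ hδ.le hqb).trans_lt hδ2))
    have h3 := hterm xb pb hpb qb hqb
    rw [← h] at h3
    simp only [F] at hΦb
    linarith [h1.2, h2.2]
  have hsT : sb < T := by
    refine lt_of_le_of_ne hsb.2 fun h => ?_
    have h1 := abs_lt.1 (hm1 tb htb' xb _ hAp qb hqb sb hsb' yb pb hpb qb hqb
      (by linarith) (by linarith) ((mixA_dist hI hδ.le hpb).trans_lt hδ1) (by simpa))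
    have h2 := abs_lt.1 (hm2 sb hsb' yb pb hpb qb hqb sb hsb' yb pb hpb _ hAq
      (by simpa) (by simpa) (by simpa)
      (by rw [dist_comm]; exact (mixA_dist hJ hδ.le hqb).trans_lt hδ2))
    have h3 := hterm yb pb hpb qb hqb
    rw [← h] at h3
    simp only [F] at hΦb
    linarith [h1.2, h2.2]
  -- subgradients
  obtain ⟨vp, hvp⟩ := exists_subgrad hI (hsub.2.1 tb xb qb)
    (by
      refine hu1.continuousOn.comp (f := fun p : Euc I => (tb, xb, p, qb)) (by fun_prop) ?_
      intro p hp
      exact ⟨htb', mem_univ _, hp, hqb⟩) hδ hδ4 hpb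
  obtain ⟨vq, hvq⟩ := exists_subgrad hJ (hsuper.2.1 sb yb pb).neg
    (by
      refine ContinuousOn.neg ?_
      refine hu2.continuousOn.comp (f := fun q : Euc J => (sb, yb, pb, q)) (by fun_prop) ?_
      intro q hq
      exact ⟨hsb', mem_univ _, hpb, hq⟩) hδ hδ4 hqb
  -- viscosity inequalities
  have hS1 := sub_ineq hsub (tst_contDiff (-α) (-β) (-γ) sb T yb) ⟨htbp, htT⟩ (xb := xb) hAp
    (qhat := -vq) hqb (M := M) (fun q hq => (abs_le.1 (hB1 tb htb' xb _ hAp q hq)).2)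
    (by
      intro t ht x q hq
      have h1 := hmax t ⟨ht.1, ht.2.le⟩ x sb hsb yb pb hpb q hq
      have h2 := hvq q hq
      simp only [Pi.neg_apply, inner_sub_right] at h2
      simp only [pen, F] at h1
      simp only [tst, inner_neg_left, neg_div]
      linarith)
    (X := scal n (-α + -β)) (tst_data (-α) (-β) (-γ) sb yb tb htbp xb)
  have hS2 := super_ineq hsuper (tst_contDiff α β γ tb T xb) ⟨hsbp, hsT⟩ (xb := yb) hAq
    (phat := vp) hpb (M := M) (fun p hp => (abs_le.1 (hB2 sb hsb' yb p hp _ hAq)).1)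
    (by
      intro s hs y p hp
      have h1 := hmax tb htb xb s ⟨hs.1, hs.2.le⟩ y p hp qb hqb
      have h2 := hvp p hp
      simp only [inner_sub_right] at h2
      simp only [pen, F] at h1
      simp only [tst, norm_sub_rev y xb, norm_sub_rev yb xb]
      linarith)
    (X := scal n (α + β)) (tst_data α β γ tb xb sb hsbp yb)
  rw [scal_neg] at hS1 hS2
  rw [show -(-α + -β) = α + β by ring, ← hX1] at hS1
  set ξ1 := -(-α • (xb - yb) + -β • xb) with hξ1
  set ξ2 := -(α • (yb - xb) + β • yb) with hξ2
  have hn1 : ‖ξ1‖ ≤ α * r + β * ‖xb‖ := by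
    have : ξ1 = α • (xb - yb) + β • xb := by rw [hξ1]; module
    rw [this]
    refine (norm_add_le _ _).trans ?_
    rw [norm_smul, norm_smul, Real.norm_of_nonneg hα.le, Real.norm_of_nonneg hβ.le]
    have := mul_le_mul_of_nonneg_left hxy hα.le
    linarith
  have hn2 : ‖ξ2‖ ≤ α * r + β * ‖yb‖ := by
    have : ξ2 = α • (xb - yb) - β • yb := by rw [hξ2]; module
    rw [this]
    refine (norm_sub_le _ _).trans ?_
    rw [norm_smul, norm_smul, Real.norm_of_nonneg hα.le, Real.norm_of_nonneg hβ.le]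
    have := mul_le_mul_of_nonneg_left hxy hα.le
    linarith
  have hn12 : ‖ξ1 - ξ2‖ ≤ β * ‖xb‖ + β * ‖yb‖ := by
    have : ξ1 - ξ2 = β • xb + β • yb := by rw [hξ1, hξ2]; module
    rw [this]
    refine (norm_add_le _ _).trans ?_
    rw [norm_smul, norm_smul, Real.norm_of_nonneg hβ.le]
  have hst := hstr 0 0 le_rfl le_rfl pb hpb _ hAq sb hsb' tb htb' xb yb ξ1 ξ2 X1
    (scal n (-(α + β))) (matLE_scal n (α + β) (by positivity))
  rw [← hr] at hst
  set arg := ‖ξ1 - ξ2‖ + 0 * ((tb - sb) ^ 2 + ‖xb - yb‖ ^ 2) + 0 + r * (1 + ‖ξ1‖ + ‖ξ2‖)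
    with harg
  have harg0 : 0 ≤ arg := by rw [harg]; positivity
  have hargρ : arg < ρ := by
    have h1 : r * (1 + ‖ξ1‖ + ‖ξ2‖) ≤ r * (1 + (α * r + ρ / 16) + (α * r + ρ / 16)) :=
      mul_le_mul_of_nonneg_left (by linarith) hr0
    have h2 : r * (1 + (α * r + ρ / 16) + (α * r + ρ / 16))
        = r + 2 * (α * r ^ 2) + r * (ρ / 8) := by ring
    have h3 : r * (ρ / 8) ≤ 1 * (ρ / 8) :=
      mul_le_mul_of_nonneg_right (by linarith) (by positivity)
    rw [harg]
    linarith
  have hωa : ω arg < γ / T ^ 2 := by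
    have := hωρ (x := arg) (by rwa [Real.dist_0_eq_abs, abs_of_nonneg harg0])
    rw [hω0, Real.dist_0_eq_abs] at this
    exact (le_abs_self _).trans_lt this
  have hxRx : ‖xb‖ ≤ Rx := by
    rw [hRx, le_div_iff₀ (by positivity)]; linarith
  have hξR : ‖ξ1‖ ≤ Rξ := by
    have := mul_le_mul_of_nonneg_left hre hα.le
    linarith
  have hHd := hHη (tb, xb, ξ1, mixA I δ pb, qb)
    ⟨htb', by simpa using hxRx, by simpa using hξR, hAp, hqb⟩
    (tb, xb, ξ1, pb, mixA J δ qb)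
    ⟨htb', by simpa using hxRx, by simpa using hξR, hpb, hAq⟩
    (by
      have h1 := (mixA_dist hI hδ.le hpb).trans_lt hδ3
      have h2 := (mixA_dist hJ hδ.le hqb).trans_lt hδ3
      rw [dist_comm] at h2
      simp only [Prod.dist_eq, max_lt_iff, dist_self]
      exact ⟨hη, hη, hη, h1, h2⟩)
  rw [Real.dist_eq] at hHd
  have hHd' := (abs_lt.1 hHd).2
  simp only at hHd'
  have hq1 : γ / T ^ 2 ≤ γ / tb ^ 2 :=
    div_le_div_of_nonneg_left hγ.le (by positivity) (pow_le_pow_left₀ htbp.le htb.2 2)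
  have hq2 : γ / T ^ 2 ≤ γ / sb ^ 2 :=
    div_le_div_of_nonneg_left hγ.le (by positivity) (pow_le_pow_left₀ hsbp.le hsb.2 2)
  rw [neg_div] at hS1
  linarith
/-- **Comparison principle** (Theorem 4.3): a bounded Hölder continuous dual subsolution
which is uniformly Lipschitz in `q` lies below a bounded Hölder continuous dual
supersolution which is uniformly Lipschitz in `p`, provided this holds at the terminal time. -/
theorem comparison_principle {n I J : ℕ} (hn : 1 ≤ n) (hI : 1 ≤ I) (hJ : 1 ≤ J)
    {T : ℝ} (hT : 0 < T)
    (H : ℝ → Euc n → Euc n → SymM (Fin n) → Euc I → Euc J → ℝ)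
    (Hcont : ContinuousOn
      (fun z : ℝ × Euc n × Euc n × SymM (Fin n) × Euc I × Euc J =>
        H z.1 z.2.1 z.2.2.1 z.2.2.2.1 z.2.2.2.2.1 z.2.2.2.2.2)
      (Icc 0 T ×ˢ (univ : Set (Euc n)) ×ˢ (univ : Set (Euc n)) ×ˢ
        (univ : Set (SymM (Fin n))) ×ˢ simplex I ×ˢ simplex J))
    (Hstruct : StructCond T H)
    (w1 w2 : ℝ → Euc n → Euc I → Euc J → ℝ)
    -- `w1` and `w2` are bounded on the domain
    (hw1bdd : ∃ M : ℝ, ∀ z ∈ dom4 T n I J, |uncur4 w1 z| ≤ M)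
    (hw2bdd : ∃ M : ℝ, ∀ z ∈ dom4 T n I J, |uncur4 w2 z| ≤ M)
    -- `w1` and `w2` are Hölder continuous on the domain
    (hw1hold : ∃ C θ : ℝ, 0 < θ ∧ θ ≤ 1 ∧ ∀ z ∈ dom4 T n I J, ∀ z' ∈ dom4 T n I J,
        |uncur4 w1 z - uncur4 w1 z'| ≤ C * dist z z' ^ θ)
    (hw2hold : ∃ C θ : ℝ, 0 < θ ∧ θ ≤ 1 ∧ ∀ z ∈ dom4 T n I J, ∀ z' ∈ dom4 T n I J,
        |uncur4 w2 z - uncur4 w2 z'| ≤ C * dist z z' ^ θ)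
    -- `w1` is uniformly Lipschitz continuous with respect to `q`
    (hw1lipq : ∃ L : ℝ, ∀ t ∈ Icc (0:ℝ) T, ∀ x : Euc n, ∀ p ∈ simplex I,
        ∀ q ∈ simplex J, ∀ q' ∈ simplex J,
          |w1 t x p q - w1 t x p q'| ≤ L * ‖q - q'‖)
    -- `w2` is uniformly Lipschitz continuous with respect to `p`
    (hw2lipp : ∃ L : ℝ, ∀ t ∈ Icc (0:ℝ) T, ∀ x : Euc n, ∀ q ∈ simplex J,
        ∀ p ∈ simplex I, ∀ p' ∈ simplex I,
          |w2 t x p q - w2 t x p' q| ≤ L * ‖p - p'‖)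
    (hsub : IsDualSubsolution T H w1)
    (hsuper : IsDualSupersolution T H w2)
    (hterm : ∀ x : Euc n, ∀ p ∈ simplex I, ∀ q ∈ simplex J, w1 T x p q ≤ w2 T x p q) :
    ∀ t ∈ Icc (0:ℝ) T, ∀ x : Euc n, ∀ p ∈ simplex I, ∀ q ∈ simplex J,
      w1 t x p q ≤ w2 t x p q := by
  obtain ⟨M1, hM1⟩ := hw1bdd
  obtain ⟨M2, hM2⟩ := hw2bdd
  have hu1 := holder_unif hw1hold
  have hu2 := holder_unif hw2hold
  have hpos : ∀ t ∈ Ioc (0:ℝ) T, ∀ x : Euc n, ∀ p ∈ simplex I, ∀ q ∈ simplex J,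
      w1 t x p q ≤ w2 t x p q := by
    intro t ht x p hp q hq
    by_contra hlt
    exact core hI hJ hT H Hcont Hstruct w1 w2 (M := |M1| + |M2| + 1) (by positivity)
      (fun z hz => by linarith [hM1 z hz, le_abs_self M1, abs_nonneg M2])
      (fun z hz => by linarith [hM2 z hz, le_abs_self M2, abs_nonneg M1])
      hu1 hu2 hsub hsuper hterm ht hp hq (not_le.1 hlt)
  intro t ht x p hp q hq
  rcases ht.1.eq_or_lt with rfl | h0
  · have hcl : (0:ℝ) ∈ closure (Ioc (0:ℝ) T) := by
      rw [closure_Ioc hT.ne]; exact ht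
    have hm : ∀ s ∈ Icc (0:ℝ) T, (s, x, p, q) ∈ dom4 T n I J :=
      fun s hs => ⟨hs, mem_univ _, hp, hq⟩
    have c1 : ContinuousOn (fun s => w1 s x p q) (Icc 0 T) :=
      hu1.continuousOn.comp (f := fun s : ℝ => (s, x, p, q)) (by fun_prop) hm
    have c2 : ContinuousOn (fun s => w2 s x p q) (Icc 0 T) :=
      hu2.continuousOn.comp (f := fun s : ℝ => (s, x, p, q)) (by fun_prop) hm
    exact ContinuousWithinAt.closure_le (f := fun s => w1 s x p q)
      (g := fun s => w2 s x p q) hcl ((c1 0 ht).mono Ioc_subset_Icc_self)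
      ((c2 0 ht).mono Ioc_subset_Icc_self) (fun s hs => hpos s hs x p hp q hq)
  · exact hpos t ⟨h0, ht.2⟩ x p hp q hq




end
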